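/- If a ≥ 8/5, then the function x ↦ (a - (1/2)·log(1-x)) / K(x) is strictly concave on (0,1); if a ≤ log 4, then it is strictly convex on (0,1). -/

import Mathlib

open Real Set Filter

noncomputable def K (x : ℝ) : ℝ :=
  ∫ t in (0 : ℝ)..(π / 2), (1 - x * Real.sin t ^ 2) ^ (-(1/2) : ℝ)

noncomputable def E (x : ℝ) : ℝ :=
  ∫ t in (0 : ℝ)..(π / 2), (1 - x * Real.sin t ^ 2) ^ ((1/2) : ℝ)

open Topology MeasureTheory

noncomputable def Bi (x : ℝ) : ℝ :=
  ∫ t in (0 : ℝ)..(π / 2), Real.cos t ^ 2 * (1 - x * Real.sin t ^ 2) ^ (-(1/2) : ℝ)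

noncomputable def Ci (x : ℝ) : ℝ :=
  ∫ t in (0 : ℝ)..(π / 2),
    Real.cos t ^ 2 * Real.sin t ^ 2 * (1 - x * Real.sin t ^ 2) ^ (-(3/2) : ℝ)

lemma delta_pos {x : ℝ} (hx : x < 1) (t : ℝ) : 0 < 1 - x * Real.sin t ^ 2 := by
  nlinarith [Real.sin_sq_add_cos_sq t, sq_nonneg (Real.sin t), sq_nonneg (Real.cos t),
    mul_nonneg (sub_nonneg.2 hx.le) (sq_nonneg (Real.sin t)), Real.sin_sq_le_one t]

lemma delta_cont {x : ℝ} (hx : x < 1) (p : ℝ) :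
    Continuous (fun t : ℝ => (1 - x * Real.sin t ^ 2) ^ p) := by
  apply Continuous.rpow_const (by fun_prop)
  intro t
  exact Or.inl (delta_pos hx t).ne'

lemma delta_split {x : ℝ} (hx : x < 1) (t : ℝ) :
    (1 - x * Real.sin t ^ 2) ^ (-(1/2) : ℝ)
      = (1 - x * Real.sin t ^ 2) * (1 - x * Real.sin t ^ 2) ^ (-(3/2) : ℝ) := by
  have h := Real.rpow_add (delta_pos hx t) 1 (-(3/2))
  rw [Real.rpow_one] at h
  rw [← h]; norm_num

lemma deriv_gen (g : ℝ → ℝ) (hg : Continuous g) {x : ℝ} (hx : x < 1) :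
    HasDerivAt (fun x => ∫ t in (0 : ℝ)..(π / 2), g t * (1 - x * Real.sin t ^ 2) ^ (-(1/2) : ℝ))
      (∫ t in (0 : ℝ)..(π / 2),
        g t * (Real.sin t ^ 2 / 2 * (1 - x * Real.sin t ^ 2) ^ (-(3/2) : ℝ))) x := by
  have hb : (1 + x) / 2 < 1 := by linarith
  refine (intervalIntegral.hasDerivAt_integral_of_dominated_loc_of_deriv_le
    (F := fun x t => g t * (1 - x * Real.sin t ^ 2) ^ (-(1/2) : ℝ))
    (F' := fun x t => g t * (Real.sin t ^ 2 / 2 * (1 - x * Real.sin t ^ 2) ^ (-(3/2) : ℝ)))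
    (s := Iio ((1 + x) / 2))
    (bound := fun t => |g t| * (Real.sin t ^ 2 / 2 *
      (1 - ((1 + x) / 2) * Real.sin t ^ 2) ^ (-(3/2) : ℝ)))
    (Iio_mem_nhds (by linarith)) ?_ ?_ ?_ ?_ ?_ ?_).2
  · filter_upwards [Iio_mem_nhds hx] with y hy
    exact (hg.mul (delta_cont hy _)).aestronglyMeasurable
  · exact (hg.mul (delta_cont hx _)).intervalIntegrable _ _
  · exact (hg.mul ((by fun_prop : Continuous fun t : ℝ => Real.sin t ^ 2 / 2).mul
      (delta_cont hx _))).aestronglyMeasurable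
  · refine Eventually.of_forall fun t _ y hy => ?_
    have hy' : y < (1 + x) / 2 := hy
    have h1 := delta_pos hb t
    have h2 := delta_pos (hy'.trans hb) t
    rw [norm_mul, Real.norm_eq_abs, Real.norm_eq_abs, abs_of_nonneg (a := Real.sin t ^ 2 / 2 * _)
      (by positivity)]
    gcongr ?_ * (?_ * ?_)
    apply Real.rpow_le_rpow_of_nonpos h1 _ (by norm_num)
    nlinarith [sq_nonneg (Real.sin t)]
  · exact ((continuous_abs.comp hg).mul ((by fun_prop : Continuous fun t : ℝ => Real.sin t ^ 2 / 2).mul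
      (delta_cont hb _))).intervalIntegrable _ _
  · refine Eventually.of_forall fun t _ y hy => ?_
    have hy' : y < (1 + x) / 2 := hy
    have h2 := delta_pos (hy'.trans hb) t
    have h3 : HasDerivAt (fun x : ℝ => 1 - x * Real.sin t ^ 2) (-(Real.sin t ^ 2)) y := by
      simpa using ((hasDerivAt_id y).mul_const (Real.sin t ^ 2)).const_sub 1
    have h4 := (h3.rpow_const (p := (-(1/2) : ℝ)) (Or.inl h2.ne')).const_mul (g t)
    refine h4.congr_deriv ?_
    rw [show (-(1/2) - 1 : ℝ) = -(3/2) by norm_num]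
    ring

lemma int_zero {x : ℝ} (hx : x < 1) :
    ∫ t in (0 : ℝ)..(π / 2), (Real.cos t ^ 2 - Real.sin t ^ 2 + x * Real.sin t ^ 4) *
      (1 - x * Real.sin t ^ 2) ^ (-(3/2) : ℝ) = 0 := by
  have := intervalIntegral.integral_eq_sub_of_hasDerivAt (a := 0) (b := π / 2)
    (f := fun t => Real.sin t * Real.cos t * (1 - x * Real.sin t ^ 2) ^ (-(1/2) : ℝ))
    (f' := fun t => (Real.cos t ^ 2 - Real.sin t ^ 2 + x * Real.sin t ^ 4) *
      (1 - x * Real.sin t ^ 2) ^ (-(3/2) : ℝ)) ?_ ?_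
  · rw [this]; simp
  · intro t _
    have h2 := delta_pos hx t
    have h3 : HasDerivAt (fun t : ℝ => 1 - x * Real.sin t ^ 2)
        (-(x * (2 * Real.sin t * Real.cos t))) t := by
      simpa using (((Real.hasDerivAt_sin t).pow 2).const_mul x).const_sub 1
    have h4 := h3.rpow_const (p := (-(1/2) : ℝ)) (Or.inl h2.ne')
    have h5 := ((Real.hasDerivAt_sin t).mul (Real.hasDerivAt_cos t)).mul h4
    refine h5.congr_deriv ?_
    rw [show (-(1/2) - 1 : ℝ) = -(3/2) by norm_num, delta_split hx t]
    have hc : Real.cos t ^ 2 = 1 - Real.sin t ^ 2 := by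
      have := Real.sin_sq_add_cos_sq t; linarith
    simp only [Pi.mul_apply]
    generalize (1 - x * Real.sin t ^ 2) ^ (-(3/2) : ℝ) = w
    linear_combination (x * Real.sin t ^ 2 * w - x * Real.sin t ^ 2 * w) * hc
  · exact ((by fun_prop : Continuous fun t : ℝ =>
      Real.cos t ^ 2 - Real.sin t ^ 2 + x * Real.sin t ^ 4).mul
      (delta_cont hx _)).intervalIntegrable _ _

lemma K_deriv {x : ℝ} (hx : x < 1) : HasDerivAt K (Bi x / (2 * (1 - x))) x := by
  have h := deriv_gen (fun _ => 1) continuous_const hx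
  simp only [one_mul] at h
  refine HasDerivAt.congr_deriv (f := K) h ?_
  have h0 := int_zero hx
  symm
  have hx' : 2 * (1 - x) ≠ 0 := by linarith
  rw [div_eq_iff hx', ← intervalIntegral.integral_mul_const, ← sub_eq_zero, Bi,
    ← intervalIntegral.integral_sub, ← h0]
  · congr 1; ext t
    rw [delta_split hx t]
    have hc : Real.cos t ^ 2 = 1 - Real.sin t ^ 2 := by
      have := Real.sin_sq_add_cos_sq t; linarith
    rw [hc]; ring
  · exact ((by fun_prop : Continuous fun t : ℝ => Real.cos t ^ 2).mul
      (delta_cont hx _)).intervalIntegrable _ _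
  · exact (((by fun_prop : Continuous fun t : ℝ => Real.sin t ^ 2 / 2).mul
      (delta_cont hx _)).mul continuous_const).intervalIntegrable _ _

lemma K_sub {x : ℝ} (hx : x < 1) : K x - 2 * Bi x = x * Ci x := by
  have h0 := int_zero hx
  have h1 : IntervalIntegrable (fun t : ℝ => (1 - x * Real.sin t ^ 2) ^ (-(1/2) : ℝ)) volume 0 (π/2) :=
    (delta_cont hx _).intervalIntegrable _ _
  have h2 : IntervalIntegrable (fun t : ℝ => 2 * (Real.cos t ^ 2 *
    (1 - x * Real.sin t ^ 2) ^ (-(1/2) : ℝ))) volume 0 (π/2) :=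
    (continuous_const.mul ((by fun_prop : Continuous fun t : ℝ => Real.cos t ^ 2).mul
      (delta_cont hx _))).intervalIntegrable _ _
  have h3 : IntervalIntegrable (fun t : ℝ => x * (Real.cos t ^ 2 * Real.sin t ^ 2 *
    (1 - x * Real.sin t ^ 2) ^ (-(3/2) : ℝ))) volume 0 (π/2) :=
    (continuous_const.mul ((by fun_prop : Continuous fun t : ℝ => Real.cos t ^ 2 * Real.sin t ^ 2).mul
      (delta_cont hx _))).intervalIntegrable _ _
  rw [K, Bi, Ci, ← intervalIntegral.integral_const_mul, ← intervalIntegral.integral_const_mul,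
    ← intervalIntegral.integral_sub h1 h2, ← sub_eq_zero,
    ← intervalIntegral.integral_sub (h1.sub h2) h3]
  rw [← neg_eq_zero, ← intervalIntegral.integral_neg]
  refine Eq.trans ?_ h0
  congr 1; ext t
  rw [delta_split hx t]
  have hc : Real.cos t ^ 2 = 1 - Real.sin t ^ 2 := by
    have := Real.sin_sq_add_cos_sq t; linarith
  rw [hc]; ring

lemma Bi_deriv' {x : ℝ} (hx : x < 1) : HasDerivAt Bi (Ci x / 2) x := by
  have h := deriv_gen (fun t => Real.cos t ^ 2) (by fun_prop) hx
  refine HasDerivAt.congr_deriv (f := Bi) h ?_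
  rw [Ci, ← intervalIntegral.integral_div]
  congr 1; ext t; ring

lemma Bi_deriv {x : ℝ} (h0 : 0 < x) (hx : x < 1) :
    HasDerivAt Bi ((K x - 2 * Bi x) / (2 * x)) x := by
  refine (Bi_deriv' hx).congr_deriv ?_
  rw [K_sub hx]; field_simp

lemma Ci_lower {x : ℝ} (h0 : 0 ≤ x) (hx : x < 1) : π / 16 ≤ Ci x := by
  have h : ∫ t in (0 : ℝ)..(π / 2), Real.cos t ^ 2 * Real.sin t ^ 2 = π / 16 := by
    have := integral_sin_sq_mul_cos_sq (a := 0) (b := π / 2)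
    rw [show (4 * (π/2)) = (2:ℕ) * π by push_cast; ring, Real.sin_nat_mul_pi] at this
    simp only [mul_comm (Real.cos _ ^ 2)]
    rw [this]; simp; ring
  rw [← h, Ci]
  apply intervalIntegral.integral_mono_on (by positivity)
  · exact (by fun_prop : Continuous fun t : ℝ => Real.cos t ^ 2 * Real.sin t ^ 2).intervalIntegrable _ _
  · exact ((by fun_prop : Continuous fun t : ℝ => Real.cos t ^ 2 * Real.sin t ^ 2).mul
      (delta_cont hx _)).intervalIntegrable _ _
  · intro t _
    apply le_mul_of_one_le_right (by positivity)
    apply Real.one_le_rpow_of_pos_of_le_one_of_nonpos (delta_pos hx t) _ (by norm_num)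
    nlinarith [sq_nonneg (Real.sin t)]

lemma Bi_upper {x : ℝ} (hx : x < 1) : Bi x ≤ 1 := by
  have h : ∫ t in (0 : ℝ)..(π / 2), Real.cos t = 1 := by simp
  rw [← h, Bi]
  apply intervalIntegral.integral_mono_on (by positivity)
  · exact ((by fun_prop : Continuous fun t : ℝ => Real.cos t ^ 2).mul
      (delta_cont hx _)).intervalIntegrable _ _
  · exact Real.continuous_cos.intervalIntegrable _ _
  · intro t ht
    have hd := delta_pos hx t
    have hc : 0 ≤ Real.cos t := Real.cos_nonneg_of_mem_Icc ⟨by linarith [ht.1, Real.pi_pos], ht.2⟩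
    rw [Real.rpow_neg hd.le, ← Real.sqrt_eq_rpow, ← div_eq_mul_inv,
      div_le_iff₀ (Real.sqrt_pos.2 hd), sq]
    apply mul_le_mul_of_nonneg_left _ hc
    apply Real.le_sqrt_of_sq_le
    nlinarith [Real.sin_sq_add_cos_sq t, sq_nonneg (Real.sin t)]

lemma Bi_lower {x : ℝ} (h0 : 0 ≤ x) (hx : x < 1) : π / 4 ≤ Bi x := by
  have h : ∫ t in (0 : ℝ)..(π / 2), Real.cos t ^ 2 = π / 4 := by
    rw [integral_cos_sq]; simp; ring
  rw [← h, Bi]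
  apply intervalIntegral.integral_mono_on (by positivity)
  · exact (by fun_prop : Continuous fun t : ℝ => Real.cos t ^ 2).intervalIntegrable _ _
  · exact ((by fun_prop : Continuous fun t : ℝ => Real.cos t ^ 2).mul
      (delta_cont hx _)).intervalIntegrable _ _
  · intro t _
    apply le_mul_of_one_le_right (by positivity)
    apply Real.one_le_rpow_of_pos_of_le_one_of_nonpos (delta_pos hx t) _ (by norm_num)
    nlinarith [sq_nonneg (Real.sin t)]

lemma K_zero : K 0 = π / 2 := by simp [K]

lemma Bi_zero : Bi 0 = π / 4 := by
  have := K_sub (x := 0) (by norm_num)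
  rw [K_zero] at this; linarith

lemma Bi_pos {x : ℝ} (h0 : 0 ≤ x) (hx : x < 1) : 0 < Bi x :=
  lt_of_lt_of_le (by positivity) (Bi_lower h0 hx)

lemma K_gt {x : ℝ} (h0 : 0 < x) (hx : x < 1) : 2 * Bi x < K x := by
  have h := K_sub hx
  have h1 := Ci_lower h0.le hx
  have h2 : 0 < Ci x := lt_of_lt_of_le (by positivity) h1
  have := mul_pos h0 h2
  linarith

lemma K_pos {x : ℝ} (h0 : 0 ≤ x) (hx : x < 1) : 0 < K x := by
  have h := K_sub hx
  have h1 := Ci_lower h0 hx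
  have h2 : 0 < Ci x := lt_of_lt_of_le (by positivity) h1
  have := mul_nonneg h0 h2.le
  have := Bi_pos h0 hx
  linarith

noncomputable def vv (x : ℝ) : ℝ := Bi x / K x

lemma vv_pos {x : ℝ} (h0 : 0 ≤ x) (hx : x < 1) : 0 < vv x :=
  div_pos (Bi_pos h0 hx) (K_pos h0 hx)

lemma vv_lt {x : ℝ} (h0 : 0 < x) (hx : x < 1) : vv x < 1 / 2 := by
  rw [vv, div_lt_iff₀ (K_pos h0.le hx)]
  linarith [K_gt h0 hx]

lemma vv_zero : vv 0 = 1 / 2 := by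
  rw [vv, K_zero, Bi_zero]; field_simp; norm_num

lemma vv_cont {x : ℝ} (h0 : 0 ≤ x) (hx : x < 1) : ContinuousAt vv x :=
  (Bi_deriv' hx).continuousAt.div (K_deriv hx).continuousAt (K_pos h0 hx).ne'

lemma vv_deriv {x : ℝ} (h0 : 0 < x) (hx : x < 1) :
    HasDerivAt vv (((1 - x) * (1 - 2 * vv x) - x * vv x ^ 2) / (2 * x * (1 - x))) x := by
  have hK := K_pos h0.le hx
  have hy : 1 - x ≠ 0 := by linarith
  refine ((Bi_deriv h0 hx).div (K_deriv hx) hK.ne').congr_deriv ?_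
  simp only [vv]
  field_simp

noncomputable def qq (x : ℝ) : ℝ :=
  2 * x * vv x ^ 2 - (1 - x) * ((1 - 2 * vv x) * (5 - 2 * vv x))

lemma qq_deriv {x : ℝ} (h0 : 0 < x) (hx : x < 1) :
    HasDerivAt qq (2 * vv x ^ 2 + (1 - 2 * vv x) * (5 - 2 * vv x) +
      (4 * x * vv x + (1 - x) * (12 - 8 * vv x)) *
      (((1 - x) * (1 - 2 * vv x) - x * vv x ^ 2) / (2 * x * (1 - x)))) x := by
  have hv := vv_deriv h0 hx
  have h1 := ((hasDerivAt_id x).const_mul 2).mul (hv.pow 2)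
  have h2 := ((hasDerivAt_id x).const_sub 1).mul
    (((hv.const_mul 2).const_sub 1).mul ((hv.const_mul 2).const_sub 5))
  refine HasDerivAt.congr_deriv (f := qq) (h1.sub h2) ?_
  simp
  ring

lemma qq_alg {x v : ℝ} (h0 : 0 < x) (hx : x < 1) (hv0 : 0 < v) (hv : v < 1 / 2)
    (hq : 2 * x * v ^ 2 - (1 - x) * ((1 - 2 * v) * (5 - 2 * v)) ≤ 0) :
    0 < 2 * v ^ 2 + (1 - 2 * v) * (5 - 2 * v) + (4 * x * v + (1 - x) * (12 - 8 * v)) *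
      (((1 - x) * (1 - 2 * v) - x * v ^ 2) / (2 * x * (1 - x))) := by
  have hy : 0 < 1 - x := by linarith
  set d := 2 * v ^ 2 + (1 - 2 * v) * (5 - 2 * v) + (4 * x * v + (1 - x) * (12 - 8 * v)) *
      (((1 - x) * (1 - 2 * v) - x * v ^ 2) / (2 * x * (1 - x))) with hd
  have key : (5 - 2 * v) ^ 2 * (2 * x * (1 - x)) * d =
      ((1 - x) * ((1 - 2 * v) * (5 - 2 * v)) - 2 * x * v ^ 2) *
        ((5 - 2 * v) * (2 * x * (5 - 2 * v) + 4 * x * v + 4 * (1 - x) * (3 - 2 * v))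
          - 8 * x * v ^ 2 * (2 - v)) + 4 * x ^ 2 * v ^ 2 * (25 - 35 * v + 12 * v ^ 2) := by
    rw [hd]; field_simp; ring
  have hA : 0 ≤ (5 - 2 * v) * (2 * x * (5 - 2 * v) + 4 * x * v + 4 * (1 - x) * (3 - 2 * v))
          - 8 * x * v ^ 2 * (2 - v) := by
    have e1 : 0 ≤ (1 - x) * ((5 - 2 * v) * (3 - 2 * v)) :=
      mul_nonneg hy.le (mul_nonneg (by linarith) (by linarith))
    have e2 : 0 ≤ x * ((5 - 2 * v) * 10 - 8 * v ^ 2 * (2 - v)) := by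
      apply mul_nonneg h0.le
      have : v ^ 2 * (2 - v) ≤ 2 := by nlinarith
      linarith
    nlinarith
  have hpos : 0 < 4 * x ^ 2 * v ^ 2 * (25 - 35 * v + 12 * v ^ 2) := by
    have : 0 < 25 - 35 * v + 12 * v ^ 2 := by nlinarith
    positivity
  have hc : 0 < (5 - 2 * v) ^ 2 * (2 * x * (1 - x)) := by
    have : 0 < 5 - 2 * v := by linarith
    positivity
  have hm := mul_nonneg (sub_nonneg.2 (sub_nonpos.1 hq)) hA
  have : 0 < (5 - 2 * v) ^ 2 * (2 * x * (1 - x)) * d := by rw [key]; linarith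
  exact (pos_iff_pos_of_mul_pos this).1 hc

lemma exists_left_lt {f : ℝ → ℝ} {d m : ℝ} (h : HasDerivAt f d m) (hd : 0 < d) (hm : 0 < m) :
    ∃ y, 0 < y ∧ y < m ∧ f y < f m := by
  have h1 := (hasDerivAt_iff_tendsto_slope.1 h).eventually (lt_mem_nhds hd)
  have h2 : ∀ᶠ y in 𝓝[<] m, 0 < slope f m y :=
    h1.filter_mono (nhdsWithin_mono _ (fun y (hy : y < m) => hy.ne))
  have h3 : ∀ᶠ y in 𝓝[<] m, y ∈ Ioo 0 m := Ioo_mem_nhdsLT hm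
  obtain ⟨y, hy1, hy2⟩ := (h2.and h3).exists
  refine ⟨y, hy2.1, hy2.2, ?_⟩
  rw [slope_def_field] at hy1
  rcases div_pos_iff.1 hy1 with h | h
  · linarith [hy2.2]
  · linarith

lemma qq_pos {x : ℝ} (h0 : 0 < x) (hx : x < 1) : 0 < qq x := by
  by_contra hneg
  have hneg : qq x ≤ 0 := not_lt.1 hneg
  have hd : ∀ m, 0 < m → m < 1 → qq m ≤ 0 → ∃ y, 0 < y ∧ y < m ∧ qq y < qq m := by
    intro m hm hm1 hq
    exact exists_left_lt (qq_deriv hm hm1)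
      (qq_alg hm hm1 (vv_pos hm.le hm1) (vv_lt hm hm1) hq) hm
  have hc : ContinuousOn qq (Icc 0 x) := by
    intro z hz
    have hv := vv_cont hz.1 (hz.2.trans_lt hx)
    apply ContinuousAt.continuousWithinAt
    unfold qq
    fun_prop
  obtain ⟨m, hm, hmin⟩ := isCompact_Icc.exists_isMinOn ⟨x, h0.le, le_rfl⟩ hc
  have hq0 : qq 0 = 0 := by simp [qq, vv_zero]
  have hno : ∀ z ∈ Icc 0 x, (∀ w ∈ Icc 0 x, qq z ≤ qq w) → 0 < z → qq z ≤ 0 → False := by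
    intro z hz hzm hz0 hzq
    obtain ⟨y, hy0, hy1, hy2⟩ := hd z hz0 (hz.2.trans_lt hx) hzq
    linarith [hzm y ⟨hy0.le, hy1.le.trans hz.2⟩]
  have hmin' : ∀ w ∈ Icc 0 x, qq m ≤ qq w := fun w hw => hmin hw
  have hxI : x ∈ Icc 0 x := ⟨h0.le, le_rfl⟩
  rcases hm.1.eq_or_lt with h | h
  · rw [← h, hq0] at hmin'
    exact hno x hxI (fun w hw => hneg.trans (hmin' w hw)) h0 hneg
  · exact hno m hm hmin' h ((hmin' x hxI).trans hneg)

noncomputable def DD (x : ℝ) : ℝ :=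
  (1 - x) * (1 - 2 * vv x) + 2 * x * (vv x * (1 - vv x))

lemma DD_pos {x : ℝ} (h0 : 0 < x) (hx : x < 1) : 0 < DD x := by
  have h1 := vv_pos h0.le hx
  have h2 := vv_lt h0 hx
  have h3 : 0 < 1 - x := by linarith
  have h4 : 0 < 1 - 2 * vv x := by linarith
  have h5 : 0 < 1 - vv x := by linarith
  unfold DD; positivity

noncomputable def GG (x : ℝ) : ℝ := 2 * x * (1 - vv x) / DD x

noncomputable def MM (x : ℝ) : ℝ := GG x + 1 / 2 * Real.log (1 - x)

lemma MM_deriv {x : ℝ} (h0 : 0 < x) (hx : x < 1) :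
    HasDerivAt MM (-qq x / (2 * DD x ^ 2)) x := by
  have hv := vv_deriv h0 hx
  have hy : 1 - x ≠ 0 := by linarith
  have hD := DD_pos h0 hx
  have hid := hasDerivAt_id x
  have h1 := ((hid.const_mul 2).mul (hv.const_sub 1))
  have h2 : HasDerivAt DD _ x := (((hid.const_sub 1).mul ((hv.const_mul 2).const_sub 1)).add
    ((hid.const_mul 2).mul (hv.mul (hv.const_sub 1))))
  have h3 := ((hid.const_sub 1).log hy).const_mul (1 / 2)
  refine HasDerivAt.congr_deriv (f := MM) ((h1.div h2 hD.ne').add h3) ?_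
  simp only [id, Pi.mul_apply]
  have hD' := hD.ne'
  unfold qq
  generalize hDe : DD x = D at *
  have hDe' : (1 - x) * (1 - 2 * vv x) + 2 * x * (vv x * (1 - vv x)) = D := hDe
  generalize vv x = v at *
  field_simp
  subst hDe'
  ring

lemma MM_anti : StrictAntiOn MM (Ioo 0 1) := by
  apply strictAntiOn_of_deriv_neg (convex_Ioo 0 1)
  · intro x hx
    exact (MM_deriv hx.1 hx.2).continuousAt.continuousWithinAt
  · intro x hx
    rw [interior_Ioo] at hx
    rw [(MM_deriv hx.1 hx.2).deriv]
    have := DD_pos hx.1 hx.2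
    have := qq_pos hx.1 hx.2
    apply div_neg_of_neg_of_pos <;> [linarith; positivity]

lemma MM_lt {x : ℝ} (h0 : 0 < x) (hx : x < 1) : MM x < 8 / 5 := by
  have key : MM (x / 2) ≤ 8 / 5 := by
    have hKc : ContinuousAt K 0 := (K_deriv (by norm_num)).continuousAt
    have hvc : ContinuousAt vv 0 := vv_cont le_rfl (by norm_num)
    have hlim : ContinuousAt (fun z => 2 * (1 - vv z) /
        ((1 - z) * (π / 16 / K z) + 2 * (vv z * (1 - vv z))) + 1 / 2 * Real.log (1 - z)) 0 := by
      apply ContinuousAt.add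
      · apply ContinuousAt.div
        · fun_prop
        · apply ContinuousAt.add
          · apply ContinuousAt.mul (by fun_prop)
            exact continuousAt_const.div hKc (by rw [K_zero]; positivity)
          · fun_prop
        · rw [K_zero, vv_zero]
          have : 0 < π := Real.pi_pos
          norm_num
          positivity
      · apply continuousAt_const.mul
        apply ContinuousAt.log (by fun_prop) (by norm_num)
    have hlim' := hlim.tendsto
    rw [K_zero, vv_zero] at hlim'
    have e : 2 * (1 - 1 / 2) / ((1 - 0) * (π / 16 / (π / 2)) + 2 * (1 / 2 * (1 - 1 / 2))) +
        1 / 2 * Real.log (1 - 0) = 8 / 5 := by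
      have : π / 16 / (π / 2) = 1 / 8 := by field_simp; norm_num
      rw [this]; norm_num
    rw [e] at hlim'
    have hlim2 := hlim'.mono_left (nhdsWithin_le_nhds (s := Ioi 0))
    refine ge_of_tendsto hlim2 ?_
    filter_upwards [Ioo_mem_nhdsGT (show (0 : ℝ) < x / 2 by linarith)] with z hz
    have hz1 : z < 1 := by linarith [hz.2]
    refine (MM_anti ⟨hz.1, hz1⟩ ⟨by linarith, by linarith⟩ hz.2).le.trans ?_
    unfold MM GG
    gcongr ?_ + _
    have hD := DD_pos hz.1 hz1
    have hK := K_pos hz.1.le hz1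
    have hv0 := vv_pos hz.1.le hz1
    have hv1 := vv_lt hz.1 hz1
    have hv2 : 0 < 1 - vv z := by linarith
    have hz2 : 0 < 1 - z := by linarith
    have hz0 := hz.1
    rw [div_le_div_iff₀ hD (by positivity)]
    have hle : z * ((1 - z) * (π / 16 / K z) + 2 * (vv z * (1 - vv z))) ≤ DD z := by
      unfold DD
      have : z * (π / 16 / K z) ≤ 1 - 2 * vv z := by
        have h := K_sub hz1
        have h' := Ci_lower hz.1.le hz1
        have : 1 - 2 * vv z = z * (Ci z / K z) := by
          unfold vv; field_simp; linarith
        rw [this]; gcongr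
      nlinarith
    nlinarith
  exact (MM_anti ⟨by linarith, by linarith⟩ ⟨h0, hx⟩ (by linarith)).trans_le key

lemma int_cos_div : ∫ t in (0 : ℝ)..(π / 2), Real.cos t / (1 + Real.sin t) = Real.log 2 := by
  have hpos : ∀ t ∈ uIcc (0 : ℝ) (π / 2), 0 < 1 + Real.sin t := by
    intro t ht
    rw [uIcc_of_le (by positivity)] at ht
    have := Real.sin_nonneg_of_nonneg_of_le_pi ht.1 (by linarith [ht.2, Real.pi_pos])
    linarith
  have := intervalIntegral.integral_eq_sub_of_hasDerivAt (a := 0) (b := π / 2)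
    (f := fun t => Real.log (1 + Real.sin t))
    (f' := fun t => Real.cos t / (1 + Real.sin t)) ?_ ?_
  · rw [this]; simp; norm_num
  · intro t ht
    exact ((Real.hasDerivAt_sin t).const_add 1).log (hpos t ht).ne'
  · apply ContinuousOn.intervalIntegrable
    exact ContinuousOn.div (by fun_prop) (by fun_prop) (fun t ht => (hpos t ht).ne')

lemma int_sin_lower {x : ℝ} (h0 : 0 ≤ x) (hx : x < 1) :
    Real.log 2 - 1 / 2 * Real.log (1 - x) ≤
    ∫ t in (0 : ℝ)..(π / 2), Real.sin t * (1 - x * Real.sin t ^ 2) ^ (-(1/2) : ℝ) := by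
  have hy : 0 < 1 - x := by linarith
  have hsy : 0 < √(1 - x) := Real.sqrt_pos.2 hy
  have hp : ∀ t, 0 < (1 - x) + Real.cos t ^ 2 := fun t => by positivity
  have hcont : Continuous (fun t => Real.sin t / √((1 - x) + Real.cos t ^ 2)) := by
    apply Continuous.div (by fun_prop) (by fun_prop)
    intro t; exact (Real.sqrt_pos.2 (hp t)).ne'
  have h := intervalIntegral.integral_eq_sub_of_hasDerivAt (a := 0) (b := π / 2)
    (f := fun t => -Real.arsinh (Real.cos t / √(1 - x)))
    (f' := fun t => Real.sin t / √((1 - x) + Real.cos t ^ 2)) ?_ (hcont.intervalIntegrable _ _)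
  · have h2 : Real.log 2 - 1 / 2 * Real.log (1 - x) ≤
        ∫ t in (0 : ℝ)..(π / 2), Real.sin t / √((1 - x) + Real.cos t ^ 2) := by
      rw [h]
      simp only [Real.cos_pi_div_two, zero_div, Real.arsinh_zero, Real.cos_zero, neg_zero, zero_sub,
        neg_neg]
      have : Real.log 2 - 1 / 2 * Real.log (1 - x) = Real.log (2 / √(1 - x)) := by
        rw [Real.log_div (by norm_num) hsy.ne', Real.log_sqrt hy.le]; ring
      rw [this, Real.arsinh]
      apply Real.log_le_log (by positivity)
      have : 1 / √(1 - x) ≤ √(1 + (1 / √(1 - x)) ^ 2) := by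
        apply Real.le_sqrt_of_sq_le; linarith
      calc 2 / √(1 - x) = 1 / √(1 - x) + 1 / √(1 - x) := by ring
        _ ≤ _ := by gcongr
    refine h2.trans ?_
    apply intervalIntegral.integral_mono_on (by positivity) (hcont.intervalIntegrable _ _)
    · exact (Real.continuous_sin.mul (delta_cont hx _)).intervalIntegrable _ _
    · intro t ht
      have hs := Real.sin_nonneg_of_nonneg_of_le_pi ht.1 (by linarith [ht.2, Real.pi_pos])
      have hd := delta_pos hx t
      rw [Real.rpow_neg hd.le, ← Real.sqrt_eq_rpow, ← div_eq_mul_inv]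
      apply div_le_div_of_nonneg_left hs (Real.sqrt_pos.2 hd)
      apply Real.sqrt_le_sqrt
      nlinarith [Real.sin_sq_add_cos_sq t, sq_nonneg (Real.cos t)]
  · intro t _
    have h1 := (((Real.hasDerivAt_cos t).div_const (√(1 - x))).arsinh).neg
    refine h1.congr_deriv ?_
    have e : √((1 - x) + Real.cos t ^ 2) = √(1 - x) * √(1 + (Real.cos t / √(1 - x)) ^ 2) := by
      rw [← Real.sqrt_mul hy.le]
      congr 1
      rw [div_pow, Real.sq_sqrt hy.le]; field_simp
    have : 0 < √(1 + (Real.cos t / √(1 - x)) ^ 2) := Real.sqrt_pos.2 (by positivity)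
    rw [e]; simp only [smul_eq_mul]; field_simp

lemma tend_one_sub_sin : Tendsto (fun x => ∫ t in (0 : ℝ)..(π / 2),
    (1 - Real.sin t) * (1 - x * Real.sin t ^ 2) ^ (-(1/2) : ℝ)) (𝓝[<] 1) (𝓝 (Real.log 2)) := by
  rw [← int_cos_div]
  have hI : Ioo (0 : ℝ) 1 ∈ 𝓝[<] (1 : ℝ) := Ioo_mem_nhdsLT (by norm_num)
  have key : ∀ t ∈ uIoc (0 : ℝ) (π / 2), 0 < Real.sin t ∧ 0 ≤ Real.cos t := by
    intro t ht
    rw [uIoc_of_le (by positivity)] at ht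
    exact ⟨Real.sin_pos_of_pos_of_lt_pi ht.1 (by linarith [ht.2, Real.pi_pos]),
      Real.cos_nonneg_of_mem_Icc ⟨by linarith [ht.1, Real.pi_pos], ht.2⟩⟩
  apply intervalIntegral.tendsto_integral_filter_of_dominated_convergence
    (fun t => Real.cos t / (1 + Real.sin t))
  · filter_upwards [hI] with x hx
    exact ((by fun_prop : Continuous fun t : ℝ => 1 - Real.sin t).mul
      (delta_cont hx.2 _)).aestronglyMeasurable
  · filter_upwards [hI] with x hx
    refine Eventually.of_forall fun t ht => ?_
    obtain ⟨hs, hc⟩ := key t ht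
    have hd := delta_pos hx.2 t
    have h1 : 0 ≤ 1 - Real.sin t := by linarith [Real.sin_le_one t]
    rw [Real.norm_of_nonneg (by positivity), Real.rpow_neg hd.le, ← Real.sqrt_eq_rpow,
      ← div_eq_mul_inv, div_le_div_iff₀ (Real.sqrt_pos.2 hd) (by linarith)]
    have h2 : Real.cos t ≤ √(1 - x * Real.sin t ^ 2) := by
      apply Real.le_sqrt_of_sq_le
      nlinarith [Real.sin_sq_add_cos_sq t, sq_nonneg (Real.sin t), hx.2]
    nlinarith [Real.sin_sq_add_cos_sq t]
  · apply ContinuousOn.intervalIntegrable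
    apply ContinuousOn.div (by fun_prop) (by fun_prop)
    intro t ht
    rw [uIcc_of_le (by positivity)] at ht
    have := Real.sin_nonneg_of_nonneg_of_le_pi ht.1 (by linarith [ht.2, Real.pi_pos])
    positivity
  · refine Eventually.of_forall fun t ht => ?_
    obtain ⟨hs, hc⟩ := key t ht
    have hsc := Real.sin_sq_add_cos_sq t
    rcases hc.eq_or_lt with h | h
    · have : Real.sin t = 1 := by nlinarith
      rw [this, ← h]; simp
    · have e : Real.cos t / (1 + Real.sin t) =
          (1 - Real.sin t) * (1 - 1 * Real.sin t ^ 2) ^ (-(1/2) : ℝ) := by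
        have : 1 - 1 * Real.sin t ^ 2 = Real.cos t ^ 2 := by linarith
        rw [this, Real.rpow_neg (by positivity), ← Real.sqrt_eq_rpow, Real.sqrt_sq hc]
        field_simp
        linarith
      rw [e]
      have : ContinuousAt (fun x : ℝ => (1 - Real.sin t) *
          (1 - x * Real.sin t ^ 2) ^ (-(1/2) : ℝ)) 1 := by
        apply continuousAt_const.mul
        apply ContinuousAt.rpow_const (by fun_prop)
        left
        have : 0 < Real.cos t ^ 2 := by positivity
        linarith
      exact this.tendsto.mono_left nhdsWithin_le_nhds

lemma K_eq_add {x : ℝ} (hx : x < 1) : K x =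
    (∫ t in (0 : ℝ)..(π / 2), Real.sin t * (1 - x * Real.sin t ^ 2) ^ (-(1/2) : ℝ)) +
    ∫ t in (0 : ℝ)..(π / 2), (1 - Real.sin t) * (1 - x * Real.sin t ^ 2) ^ (-(1/2) : ℝ) := by
  rw [K, ← intervalIntegral.integral_add]
  · congr 1; ext t; ring
  · exact (Real.continuous_sin.mul (delta_cont hx _)).intervalIntegrable _ _
  · exact ((by fun_prop : Continuous fun t : ℝ => 1 - Real.sin t).mul
      (delta_cont hx _)).intervalIntegrable _ _

lemma K_upper {x : ℝ} (h0 : 0 ≤ x) (hx : x < 1) : K x ≤ π / 2 - 1 / 2 * Real.log (1 - x) := by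
  have hder : ∀ z < (1 : ℝ), HasDerivAt (fun z => K z + 1 / 2 * Real.log (1 - z))
      ((Bi z - 1) / (2 * (1 - z))) z := by
    intro z hz
    have hy : 1 - z ≠ 0 := by linarith
    refine ((K_deriv hz).add ((((hasDerivAt_id z).const_sub 1).log hy).const_mul (1 / 2))).congr_deriv ?_
    simp only [id]
    field_simp
    ring
  have : AntitoneOn (fun z => K z + 1 / 2 * Real.log (1 - z)) (Icc 0 x) := by
    apply antitoneOn_of_deriv_nonpos (convex_Icc 0 x)
    · intro z hz
      exact (hder z (hz.2.trans_lt hx)).continuousAt.continuousWithinAt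
    · intro z hz
      rw [interior_Icc] at hz
      exact (hder z (hz.2.trans hx)).differentiableAt.differentiableWithinAt
    · intro z hz
      rw [interior_Icc] at hz
      have hz1 := hz.2.trans hx
      rw [(hder z hz1).deriv]
      apply div_nonpos_of_nonpos_of_nonneg
      · linarith [Bi_upper hz1]
      · linarith
  have h := this ⟨le_rfl, h0⟩ ⟨h0, le_rfl⟩ h0
  simp [K_zero] at h
  linarith

lemma tend_yK : Tendsto (fun x => (1 - x) * (π / 2 - 1 / 2 * Real.log (1 - x)) ^ 2)
    (𝓝[<] 1) (𝓝 0) := by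
  have h1 : Tendsto (fun x : ℝ => 1 - x) (𝓝[<] 1) (𝓝[>] 0) := by
    apply tendsto_nhdsWithin_of_tendsto_nhds_of_eventually_within
    · have : Tendsto (fun x : ℝ => 1 - x) (𝓝 1) (𝓝 (1 - 1)) :=
        (by fun_prop : Continuous fun x : ℝ => 1 - x).tendsto 1
      rw [sub_self] at this
      exact this.mono_left nhdsWithin_le_nhds
    · filter_upwards [self_mem_nhdsWithin] with x hx
      have : x < 1 := hx
      simp [this]
  have h2 := tendsto_log_mul_rpow_nhdsGT_zero (r := 1 / 2) (by norm_num)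
  have h3 : Tendsto (fun y : ℝ => y ^ (1 / 2 : ℝ)) (𝓝[>] 0) (𝓝 0) := by
    have := (Real.continuous_rpow_const (q := 1 / 2) (by norm_num)).tendsto 0
    rw [Real.zero_rpow (by norm_num)] at this
    exact this.mono_left nhdsWithin_le_nhds
  have h4 := ((h3.const_mul (π / 2)).sub (h2.const_mul (1 / 2))).pow 2
  have h5 := h4.comp h1
  simp only [mul_zero, sub_zero] at h5
  rw [show (0 : ℝ) ^ 2 = 0 by norm_num] at h5
  refine h5.congr' ?_
  filter_upwards [self_mem_nhdsWithin] with x hx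
  have hx : x < 1 := hx
  have hs : ((1 - x) ^ (1 / 2 : ℝ)) ^ 2 = 1 - x := by
    rw [← Real.sqrt_eq_rpow, Real.sq_sqrt (by linarith)]
  simp only [Function.comp]
  linear_combination (π / 2 - 1 / 2 * Real.log (1 - x)) ^ 2 * hs

lemma GG_lower {x : ℝ} (h0 : 1 / 2 < x) (hx : x < 1) :
    K x - 4 * ((1 - x) * K x ^ 2) ≤ GG x := by
  have h0' : 0 < x := by linarith
  have hK := K_pos h0'.le hx
  have hv0 := vv_pos h0'.le hx
  have hv1 := vv_lt h0' hx
  have hD := DD_pos h0' hx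
  have hB := Bi_pos h0'.le hx
  have hy : 0 < 1 - x := by linarith
  have e : GG x = 1 / vv x - (1 - x) * (1 - 2 * vv x) / (vv x * DD x) := by
    unfold GG
    have hD' := hD.ne'
    field_simp
    unfold DD
    ring
  have h1 : K x ≤ 1 / vv x := by
    rw [vv, one_div_div, le_div_iff₀ hB]
    nlinarith [Bi_upper hx]
  have h2 : vv x / 2 ≤ DD x := by
    unfold DD
    have a1 : 0 ≤ (1 - x) * (1 - 2 * vv x) := mul_nonneg hy.le (by linarith)
    have a2 : vv x / 2 ≤ vv x * (1 - vv x) := by nlinarith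
    nlinarith
  have h3 : vv x * K x = Bi x := by unfold vv; field_simp
  have h4 : 3 / 4 ≤ Bi x := by linarith [Bi_lower h0'.le hx, Real.pi_gt_three]
  have h5 : (1 - x) * (1 - 2 * vv x) / (vv x * DD x) ≤ 4 * ((1 - x) * K x ^ 2) := by
    rw [div_le_iff₀ (by positivity)]
    have b1 : 1 ≤ 2 * Bi x ^ 2 := by nlinarith
    have b2 : 2 * Bi x ^ 2 ≤ 4 * K x ^ 2 * (vv x * DD x) := by
      rw [← h3]
      have : 4 * K x ^ 2 * (vv x * (vv x / 2)) ≤ 4 * K x ^ 2 * (vv x * DD x) := by gcongr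
      linarith
    have b3 : 1 - 2 * vv x ≤ 4 * K x ^ 2 * (vv x * DD x) := by linarith
    have := mul_le_mul_of_nonneg_left b3 hy.le
    linarith
  rw [e]; linarith

lemma MM_gt {x : ℝ} (h0 : 0 < x) (hx : x < 1) : Real.log 4 < MM x := by
  have key : Real.log 4 ≤ MM ((1 + x) / 2) := by
    have hlim := (tend_one_sub_sin.const_add (Real.log 2)).sub (tend_yK.const_mul 4)
    have e : Real.log 2 + Real.log 2 - 4 * 0 = Real.log 4 := by
      rw [show (4 : ℝ) = 2 * 2 by norm_num, Real.log_mul (by norm_num) (by norm_num)]; ring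
    rw [e] at hlim
    refine le_of_tendsto hlim ?_
    filter_upwards [Ioo_mem_nhdsLT (show (1 + x) / 2 < 1 by linarith)] with z hz
    have hz0 : 0 < z := by linarith [hz.1]
    refine le_trans ?_ (MM_anti ⟨by linarith, by linarith⟩ ⟨hz0, hz.2⟩ hz.1).le
    have g1 := GG_lower (by linarith [hz.1]) hz.2
    have g2 := int_sin_lower hz0.le hz.2
    have g3 := K_eq_add hz.2
    have g4 : (1 - z) * K z ^ 2 ≤ (1 - z) * (π / 2 - 1 / 2 * Real.log (1 - z)) ^ 2 := by
      have := K_upper hz0.le hz.2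
      have := (K_pos hz0.le hz.2).le
      have : 0 ≤ 1 - z := by linarith [hz.2]
      gcongr
    unfold MM
    linarith
  exact key.trans_lt (MM_anti ⟨h0, hx⟩ ⟨by linarith, by linarith⟩ (by linarith))

noncomputable def f1 (a x : ℝ) : ℝ :=
  (K x - (a - 1 / 2 * Real.log (1 - x)) * Bi x) / (2 * (1 - x) * K x ^ 2)

lemma f_deriv (a : ℝ) {x : ℝ} (h0 : 0 < x) (hx : x < 1) :
    HasDerivAt (fun x : ℝ => (a - (1/2) * Real.log (1 - x)) / K x) (f1 a x) x := by
  have hy : 1 - x ≠ 0 := by linarith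
  have hK := (K_pos h0.le hx).ne'
  have hN := ((((hasDerivAt_id x).const_sub 1).log hy).const_mul (1 / 2)).const_sub a
  refine (hN.div (K_deriv hx) hK).congr_deriv ?_
  simp only [id, f1]
  field_simp

lemma f1_deriv (a : ℝ) {x : ℝ} (h0 : 0 < x) (hx : x < 1) :
    HasDerivAt (f1 a) ((MM x - a) * (DD x / (4 * x * (1 - x) ^ 2 * K x))) x := by
  have hy : 1 - x ≠ 0 := by linarith
  have hK := (K_pos h0.le hx).ne'
  have hid := hasDerivAt_id x
  have hN := (((hid.const_sub 1).log hy).const_mul (1 / 2)).const_sub a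
  have h1 := (K_deriv hx).sub (hN.mul (Bi_deriv h0 hx))
  have h2 := ((hid.const_sub 1).const_mul 2).mul ((K_deriv hx).pow 2)
  have hne : 2 * (1 - x) * K x ^ 2 ≠ 0 := by simp [hy, hK]
  refine HasDerivAt.congr_deriv (f := f1 a) (h1.div h2 hne) ?_
  have hD := (DD_pos h0 hx).ne'
  have e : (MM x - a) * (DD x / (4 * x * (1 - x) ^ 2 * K x)) =
      (2 * x * (1 - vv x) - (a - 1 / 2 * Real.log (1 - x)) * DD x) /
        (4 * x * (1 - x) ^ 2 * K x) := by
    unfold MM GG; field_simp; ring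
  rw [e]
  simp only [id, DD, vv, Pi.mul_apply, Pi.sub_apply, Pi.pow_apply]
  generalize Real.log (1 - x) = L
  field_simp
  ring

theorem stmt11 (a : ℝ) :
    (a ≥ 8/5 → StrictConcaveOn ℝ (Ioo 0 1)
      (fun x : ℝ => (a - (1/2) * Real.log (1 - x)) / K x)) ∧
    (a ≤ Real.log 4 → StrictConvexOn ℝ (Ioo 0 1)
      (fun x : ℝ => (a - (1/2) * Real.log (1 - x)) / K x)) := by
  have hco : ContinuousOn (fun x : ℝ => (a - (1/2) * Real.log (1 - x)) / K x) (Ioo 0 1) :=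
    fun x hx => (f_deriv a hx.1 hx.2).continuousAt.continuousWithinAt
  have hde : EqOn (f1 a) (deriv (fun x : ℝ => (a - (1/2) * Real.log (1 - x)) / K x)) (Ioo 0 1) :=
    fun x hx => ((f_deriv a hx.1 hx.2).deriv).symm
  have hco1 : ContinuousOn (f1 a) (Ioo 0 1) :=
    fun x hx => (f1_deriv a hx.1 hx.2).continuousAt.continuousWithinAt
  have hp : ∀ x ∈ Ioo (0 : ℝ) 1, 0 < DD x / (4 * x * (1 - x) ^ 2 * K x) := by
    intro x hx
    have h1 := DD_pos hx.1 hx.2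
    have h2 := K_pos hx.1.le hx.2
    have h3 : 0 < 1 - x := by linarith [hx.2]
    have h4 := hx.1
    positivity
  constructor
  · intro ha
    apply StrictAntiOn.strictConcaveOn_of_deriv (convex_Ioo 0 1) hco
    rw [interior_Ioo]
    refine StrictAntiOn.congr ?_ hde
    apply strictAntiOn_of_deriv_neg (convex_Ioo 0 1) hco1
    intro x hx
    rw [interior_Ioo] at hx
    rw [(f1_deriv a hx.1 hx.2).deriv]
    have := MM_lt hx.1 hx.2
    exact mul_neg_of_neg_of_pos (by linarith) (hp x hx)
  · intro ha
    apply StrictMonoOn.strictConvexOn_of_deriv (convex_Ioo 0 1) hco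
    rw [interior_Ioo]
    refine StrictMonoOn.congr ?_ hde
    apply strictMonoOn_of_deriv_pos (convex_Ioo 0 1) hco1
    intro x hx
    rw [interior_Ioo] at hx
    rw [(f1_deriv a hx.1 hx.2).deriv]
    have := MM_gt hx.1 hx.2
    exact mul_pos (by linarith) (hp x hx)
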